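/- (Representation of ET-systems) Let u_0, ..., u_N be linearly independent functions of class C^N on [a,b] whose span U has the ET-property: whenever u ∈ U, t_1, ..., t_m are distinct points of [a,b], and d_1, ..., d_m are nonnegative integers with ∑_{j=1}^{m}(d_j + 1) ≥ N + 1 and u^{(k)}(t_j) = 0 for all 1 ≤ j ≤ m, 0 ≤ k ≤ d_j, then u ≡ 0. Then there exist functions w_0, w_1, ..., w_N with w_i of class C^{N−i} on [a,b] and w_i(t) > 0 for all t ∈ [a,b], such that the functions v_0(t) = w_0(t), v_1(t) = w_0(t) ∫_a^t w_1(t_1) dt_1, ..., v_N(t) = w_0(t) ∫_a^t w_1(t_1) ∫_a^{t_1} w_2(t_2) ⋯ ∫_a^{t_{N−1}} w_N(t_N) dt_N ⋯ dt_1 form a basis of U. -/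

import Mathlib

/-- The nested integral `nestInt w a i k t = ∫_a^t w i (t_i) ∫_a^{t_i} w (i+1) (t_{i+1}) ⋯
∫_a^{t_{k-1}} w k (t_k) dt_k ⋯ dt_i`, equal to `1` when `i > k`. -/
noncomputable def nestInt (w : ℕ → ℝ → ℝ) (a : ℝ) (i k : ℕ) (t : ℝ) : ℝ :=
  if k < i then 1 else ∫ s in a..t, w i s * nestInt w a (i + 1) k s
termination_by k + 1 - i
decreasing_by omega

open Set

theorem integral_derivWithin_Icc_eq_sub {a b : ℝ} {f : ℝ → ℝ} (hab : a < b)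
    (hf : ContDiffOn ℝ 1 f (Icc a b)) {t : ℝ} (ht : t ∈ Icc a b) :
    ∫ s in a..t, derivWithin f (Icc a b) s = f t - f a := by
  have hsub : Icc a t ⊆ Icc a b := Icc_subset_Icc_right ht.2
  have hcont : ContinuousOn (derivWithin f (Icc a b)) (Icc a b) :=
    hf.continuousOn_derivWithin (uniqueDiffOn_Icc hab) le_rfl
  refine intervalIntegral.integral_eq_sub_of_hasDerivAt_of_le ht.1 (hf.continuousOn.mono hsub)
    (fun x hx ↦ ?_) ((hcont.mono ?_).intervalIntegrable)
  · have hx' : x ∈ Icc a b := hsub (Ioo_subset_Icc_self hx)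
    exact ((hf.differentiableOn one_ne_zero x hx').hasDerivWithinAt).hasDerivAt
      (Icc_mem_nhds hx.1 (hx.2.trans_le ht.2))
  · rwa [uIcc_of_le ht.1]

/-- A `C^N` function on a compact interval extends to a `C^N` function on the line. -/
theorem ContDiffOn.exists_contDiff_eqOn_Icc {a b : ℝ} (hab : a < b) (N : ℕ) {f : ℝ → ℝ}
    (hf : ContDiffOn ℝ N f (Icc a b)) : ∃ g : ℝ → ℝ, ContDiff ℝ N g ∧ EqOn g f (Icc a b) := by
  induction N generalizing f with
  | zero =>
    refine ⟨IccExtend hab.le ((Icc a b).domRestrict f), ?_, fun x hx ↦ ?_⟩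
    · exact contDiff_zero.2
        (continuousOn_iff_continuous_domRestrict.1 hf.continuousOn).Icc_extend'
    · simp [IccExtend_of_mem hab.le _ hx]
  | succ N ih =>
    have hu := uniqueDiffOn_Icc hab
    obtain ⟨g, hg, hgf⟩ := ih (hf.derivWithin hu (m := N) (by simp))
    have hd (x : ℝ) : HasDerivAt (fun x ↦ f a + ∫ s in a..x, g s) (g x) x :=
      ((hg.continuous.integral_hasStrictDerivAt a x).hasDerivAt).const_add _
    refine ⟨fun x ↦ f a + ∫ s in a..x, g s, ?_, fun x hx ↦ ?_⟩
    · push_cast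
      refine contDiff_succ_iff_deriv.2 ⟨fun x ↦ (hd x).differentiableAt, by simp, ?_⟩
      rwa [funext fun x ↦ (hd x).deriv]
    · have h1 : ∫ s in a..x, g s = ∫ s in a..x, derivWithin f (Icc a b) s := by
        refine intervalIntegral.integral_congr fun s hs ↦ hgf ?_
        rw [uIcc_of_le hx.1] at hs
        exact ⟨hs.1, hs.2.trans hx.2⟩
      have h2 := integral_derivWithin_Icc_eq_sub hab (hf.of_le (by simp)) hx
      simp [h1, h2]

/-- The function `∑_{i < n} (-1)^i f^{(n-1-i)} K^{(i)}` that appears when `f^{(n)} K` is integrated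
by parts `n` times has derivative `f^{(n)} K` if `K` is a polynomial of degree less than `n`. -/
theorem hasDerivAt_sum_iteratedDeriv_mul_iterate_derivative {f : ℝ → ℝ} {n : ℕ}
    (hf : ContDiff ℝ n f) (K : Polynomial ℝ) (hK : K.natDegree < n) (x : ℝ) :
    HasDerivAt (fun y ↦ ∑ i ∈ Finset.range n, (-1) ^ i * (iteratedDeriv (n - 1 - i) f y *
      (Polynomial.derivative^[i] K).eval y)) (iteratedDeriv n f x * K.eval x) x := by
  have hterm : ∀ i ∈ Finset.range n, HasDerivAt
      (fun y ↦ (-1) ^ i * (iteratedDeriv (n - 1 - i) f y *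
        (Polynomial.derivative^[i] K).eval y))
      ((-1) ^ i * (iteratedDeriv (n - i) f x * (Polynomial.derivative^[i] K).eval x) -
        (-1) ^ (i + 1) * (iteratedDeriv (n - (i + 1)) f x *
          (Polynomial.derivative^[i + 1] K).eval x)) x := by
    intro i hi
    have hi : i < n := Finset.mem_range.1 hi
    have hd := (hf.differentiable_iteratedDeriv (n - 1 - i)
      (by exact_mod_cast (by omega : n - 1 - i < n)) x).hasDerivAt
    rw [← iteratedDeriv_succ, show n - 1 - i + 1 = n - i by omega] at hd
    refine ((hd.mul (Polynomial.hasDerivAt (Polynomial.derivative^[i] K) x)).const_mul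
      ((-1 : ℝ) ^ i)).congr_deriv ?_
    rw [Function.iterate_succ_apply', show n - (i + 1) = n - 1 - i by omega]
    ring
  refine (HasDerivAt.fun_sum hterm).congr_deriv ?_
  rw [Finset.sum_range_sub']
  simp [Polynomial.iterate_derivative_eq_zero hK]

/-- **Rolle's theorem** with two nodes of multiplicities `p` and `q`. -/
theorem exists_iteratedDeriv_eq_zero {f : ℝ → ℝ} {n p q : ℕ} (hf : ContDiff ℝ n f)
    {t c : ℝ} (htc : t < c) (hpq : n + 1 ≤ p + q)
    (hp : ∀ j < p, iteratedDeriv j f t = 0) (hq : ∀ j < q, iteratedDeriv j f c = 0) :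
    ∃ ξ ∈ Icc t c, iteratedDeriv n f ξ = 0 := by
  by_cases hnp : n < p
  · exact ⟨t, left_mem_Icc.2 htc.le, hp n hnp⟩
  by_cases hnq : n < q
  · exact ⟨c, right_mem_Icc.2 htc.le, hq n hnq⟩
  push Not at hnp hnq
  let P : Polynomial ℝ := .X - .C t
  let Q : Polynomial ℝ := .X - .C c
  let K : Polynomial ℝ := P ^ (n - p) * Q ^ (p - 1)
  have hdeg : K.natDegree < n := by
    refine (Polynomial.natDegree_mul_le.trans (add_le_add Polynomial.natDegree_pow_le
      Polynomial.natDegree_pow_le)).trans_lt ?_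
    simp only [P, Q, Polynomial.natDegree_X_sub_C]
    omega
  have hKt (i : ℕ) (hi : i < n - p) : (Polynomial.derivative^[i] K).eval t = 0 := by
    obtain ⟨R, hR⟩ := Polynomial.pow_sub_dvd_iterate_derivative_of_pow_dvd (p := K) (q := P) i
      (Dvd.intro _ rfl)
    rw [hR]
    simp [P, show n - p - i ≠ 0 by omega]
  have hKc (i : ℕ) (hi : i < p - 1) : (Polynomial.derivative^[i] K).eval c = 0 := by
    obtain ⟨R, hR⟩ := Polynomial.pow_sub_dvd_iterate_derivative_of_pow_dvd (p := K) (q := Q) i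
      (Dvd.intro_left _ rfl)
    rw [hR]
    simp [Q, show p - 1 - i ≠ 0 by omega]
  have hB := hasDerivAt_sum_iteratedDeriv_mul_iterate_derivative hf K hdeg
  have hzero (x : ℝ) (hx : ∀ i < n, iteratedDeriv (n - 1 - i) f x = 0 ∨
      (Polynomial.derivative^[i] K).eval x = 0) :
      ∑ i ∈ Finset.range n, (-1) ^ i * (iteratedDeriv (n - 1 - i) f x *
        (Polynomial.derivative^[i] K).eval x) = 0 :=
    Finset.sum_eq_zero fun i hi ↦ by simp [hx i (Finset.mem_range.1 hi)]
  have hBt := hzero t fun i hi ↦ (lt_or_ge i (n - p)).elim (fun h ↦ .inr (hKt i h))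
    fun h ↦ .inl (hp _ (by omega))
  have hBc := hzero c fun i hi ↦ (lt_or_ge i (p - 1)).elim (fun h ↦ .inr (hKc i h))
    fun h ↦ .inl (hq _ (by omega))
  obtain ⟨ξ, hξ, h0⟩ := exists_hasDerivAt_eq_zero htc
    (fun x _ ↦ (hB x).continuousAt.continuousWithinAt) (hBt.trans hBc.symm) fun x _ ↦ hB x
  refine ⟨ξ, Ioo_subset_Icc_self hξ, (mul_eq_zero.1 h0).resolve_right ?_⟩
  simp [K, P, Q, sub_eq_zero, hξ.1.ne', hξ.2.ne]

theorem iteratedDeriv_linear_combination {ι : Type*} [Fintype ι] {N j : ℕ} (hj : j ≤ N)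
    {u : ι → ℝ → ℝ} (hu : ∀ i, ContDiff ℝ N (u i)) (lam : ι → ℝ) (x : ℝ) :
    iteratedDeriv j (fun y ↦ ∑ i, lam i * u i y) x = ∑ i, lam i * iteratedDeriv j (u i) x := by
  rw [iteratedDeriv_fun_sum fun i _ ↦
    (contDiff_const.mul ((hu i).of_le (by exact_mod_cast hj))).contDiffAt]
  simp

/-- If Hermite interpolation with one node `t ∈ [a,b]` and the node `b` is uniquely solvable in the
span of the `u i`, then this remains true when `b` is replaced by a suitable node `c > b`. -/
theorem exists_gt_hermite_unique {ι : Type*} [Fintype ι] {a b : ℝ} {N : ℕ} {u : ι → ℝ → ℝ}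
    (hu : ∀ i, ContDiff ℝ N (u i))
    (h : ∀ p q, p + q = N + 1 → ∀ t ∈ Icc a b, t < b ∨ p = 0 → ∀ lam : ι → ℝ,
      (∀ j < p, ∑ i, lam i * iteratedDeriv j (u i) t = 0) →
      (∀ j < q, ∑ i, lam i * iteratedDeriv j (u i) b = 0) → lam = 0) :
    ∃ c > b, ∀ p q, p + q = N + 1 → ∀ t ∈ Icc a b, ∀ lam : ι → ℝ,
      (∀ j < p, ∑ i, lam i * iteratedDeriv j (u i) t = 0) →
      (∀ j < q, ∑ i, lam i * iteratedDeriv j (u i) c = 0) → lam = 0 := by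
  have hcont (j : ℕ) (hj : j ≤ N) :
      Continuous fun y : (ι → ℝ) × ℝ ↦ ∑ i, y.1 i * iteratedDeriv j (u i) y.2 := by
    have (i : ι) := (hu i).continuous_iteratedDeriv j (by exact_mod_cast hj)
    fun_prop
  let T := (ι → ℝ) × ℝ × ℝ × (Fin (N + 1) → ℝ)
  let S (p : ℕ) : Set T := {y | (∀ j : Fin (N + 1), y.2.1 ≤ y.2.2.2 j ∧ y.2.2.2 j ≤ y.2.2.1 ∧
      ∑ i, y.1 i * iteratedDeriv j (u i) (y.2.2.2 j) = 0) ∧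
    (∀ j : Fin (N + 1), j < p → ∑ i, y.1 i * iteratedDeriv j (u i) y.2.1 = 0) ∧
    ∀ j : Fin (N + 1), j < N + 1 - p → ∑ i, y.1 i * iteratedDeriv j (u i) y.2.2.1 = 0}
  have hS (p : ℕ) : IsClosed (S p) := by
    have h1 (j : Fin (N + 1)) :
        Continuous fun y : T ↦ ∑ i, y.1 i * iteratedDeriv j (u i) (y.2.2.2 j) :=
      (hcont j (by omega)).comp (by fun_prop : Continuous fun y : T ↦ (y.1, y.2.2.2 j))
    have h2 (j : Fin (N + 1)) :
        Continuous fun y : T ↦ ∑ i, y.1 i * iteratedDeriv j (u i) y.2.1 :=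
      (hcont j (by omega)).comp (by fun_prop : Continuous fun y : T ↦ (y.1, y.2.1))
    have h3 (j : Fin (N + 1)) :
        Continuous fun y : T ↦ ∑ i, y.1 i * iteratedDeriv j (u i) y.2.2.1 :=
      (hcont j (by omega)).comp (by fun_prop : Continuous fun y : T ↦ (y.1, y.2.2.1))
    simp only [S, ofPred_and, ofPred_forall]
    refine .inter (isClosed_iInter fun j ↦ .inter ?_ (.inter ?_ ?_))
      (.inter (isClosed_iInter fun j ↦ isClosed_iInter fun _ ↦ ?_)
        (isClosed_iInter fun j ↦ isClosed_iInter fun _ ↦ ?_))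
    · exact isClosed_le (by fun_prop) (by fun_prop)
    · exact isClosed_le (by fun_prop) (by fun_prop)
    · exact isClosed_eq (h1 j) continuous_const
    · exact isClosed_eq (h2 j) continuous_const
    · exact isClosed_eq (h3 j) continuous_const
  let B : Set T := Metric.sphere 0 1 ×ˢ Icc a b ×ˢ Icc b (b + 1) ×ˢ
    Icc (fun _ ↦ a) (fun _ ↦ b + 1)
  have hB : IsCompact B := (isCompact_sphere _ _).prod
    (isCompact_Icc.prod (isCompact_Icc.prod isCompact_Icc))
  have hK (p : ℕ) : IsClosed ((fun y : T ↦ y.2.2.1) '' (B ∩ S p)) :=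
    ((hB.inter_right (hS p)).image (by fun_prop)).isClosed
  have hb (p : ℕ) (hp : p ≤ N + 1) : b ∉ (fun y : T ↦ y.2.2.1) '' (B ∩ S p) := by
    rintro ⟨⟨lam, t, c, ξ⟩, ⟨⟨hlam, ht, -, -⟩, hξ, hpt, hqb⟩, rfl⟩
    dsimp only at *
    have hne : lam ≠ 0 := by
      rintro rfl
      simp at hlam
    rcases ht.2.lt_or_eq with htb | rfl
    · exact hne (h p (N + 1 - p) (by omega) t ht (.inl htb) lam
        (fun j hj ↦ hpt ⟨j, by omega⟩ hj) fun j hj ↦ hqb ⟨j, by omega⟩ hj)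
    · refine hne (h 0 (N + 1) (by omega) t ht (.inr rfl) lam (by simp) fun j hj ↦ ?_)
      obtain ⟨h1, h2, h3⟩ := hξ ⟨j, hj⟩
      rwa [le_antisymm h2 h1] at h3
  have hev : ∀ᶠ c in nhdsWithin b (Ioi b), c < b + 1 ∧ b < c ∧ ∀ p ∈ Finset.range (N + 2),
      c ∉ (fun y : T ↦ y.2.2.1) '' (B ∩ S p) := by
    refine .and (nhdsWithin_le_nhds (Iio_mem_nhds (by linarith)))
      (.and self_mem_nhdsWithin (nhdsWithin_le_nhds ((Filter.eventually_all_finset _).2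
        fun p hp ↦ (hK p).isOpen_compl.mem_nhds (hb p ?_))))
    simp at hp
    omega
  obtain ⟨c, hc1, hbc, hc⟩ := hev.exists
  refine ⟨c, hbc, fun p q hpq t ht lam hpt hqc ↦ by_contra fun hne ↦ ?_⟩
  have hnorm : ‖lam‖ ≠ 0 := norm_ne_zero_iff.2 hne
  have hscale (j : ℕ) (x : ℝ) (h0 : ∑ i, lam i * iteratedDeriv j (u i) x = 0) :
      ∑ i, (‖lam‖⁻¹ • lam) i * iteratedDeriv j (u i) x = 0 := by
    simp [mul_assoc, ← Finset.mul_sum, h0]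
  have hrolle (j : Fin (N + 1)) :
      ∃ ξ ∈ Icc t c, ∑ i, lam i * iteratedDeriv j (u i) ξ = 0 := by
    have hf : ContDiff ℝ N fun y ↦ ∑ i, lam i * u i y :=
      .sum fun i _ ↦ contDiff_const.mul (hu i)
    have heq (i : ℕ) (hi : i ≤ N) (x : ℝ) := iteratedDeriv_linear_combination hi hu lam x
    obtain ⟨ξ, hξ, h0⟩ := exists_iteratedDeriv_eq_zero (n := j) (p := p) (q := q)
      (hf.of_le (by exact_mod_cast (by omega : (j : ℕ) ≤ N))) (ht.2.trans_lt hbc) (by omega)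
      (fun i hi ↦ (heq i (by omega) t).trans (hpt i hi))
      (fun i hi ↦ (heq i (by omega) c).trans (hqc i hi))
    exact ⟨ξ, hξ, (heq j (by omega) ξ).symm.trans h0⟩
  choose ξ hξ h0 using hrolle
  refine hc p (Finset.mem_range.2 (by omega)) ⟨(‖lam‖⁻¹ • lam, t, c, ξ), ⟨⟨?_, ht,
    ⟨hbc.le, hc1.le⟩, fun j ↦ ht.1.trans (hξ j).1, fun j ↦ (hξ j).2.trans hc1.le⟩,
    fun j ↦ ⟨(hξ j).1, (hξ j).2, hscale _ _ (h0 j)⟩, fun j hj ↦ hscale _ _ (hpt j hj),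
    fun j hj ↦ hscale _ _ (hqc j (by omega))⟩, rfl⟩
  simp [norm_smul, hnorm]

theorem nestInt_of_lt {w : ℕ → ℝ → ℝ} {a : ℝ} {i k : ℕ} (h : k < i) (t : ℝ) :
    nestInt w a i k t = 1 := by
  rw [nestInt, if_pos h]

theorem nestInt_of_le {w : ℕ → ℝ → ℝ} {a : ℝ} {i k : ℕ} (h : i ≤ k) (t : ℝ) :
    nestInt w a i k t = ∫ s in a..t, w i s * nestInt w a (i + 1) k s := by
  rw [nestInt, if_neg h.not_gt]

theorem nestInt_succ_succ (w : ℕ → ℝ → ℝ) (a : ℝ) (i k : ℕ) (t : ℝ) :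
    nestInt w a (i + 1) (k + 1) t = nestInt (fun n ↦ w (n + 1)) a i k t := by
  induction hd : k + 1 - i generalizing i t with
  | zero => rw [nestInt_of_lt (by omega), nestInt_of_lt (by omega)]
  | succ d ih =>
    rw [nestInt_of_le (by omega), nestInt_of_le (by omega)]
    simp only [fun s ↦ ih (i + 1) s (by omega)]

theorem continuousOn_nestInt {w : ℕ → ℝ → ℝ} {a b : ℝ} (hab : a ≤ b) {k : ℕ}
    (hw : ∀ n ≤ k, ContinuousOn (w n) (Icc a b)) (i : ℕ) :
    ContinuousOn (nestInt w a i k) (Icc a b) := by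
  induction hd : k + 1 - i generalizing i with
  | zero =>
    rw [funext fun t ↦ nestInt_of_lt (w := w) (a := a) (by omega : k < i) t]
    exact continuousOn_const
  | succ d ih =>
    rw [funext fun t ↦ nestInt_of_le (w := w) (a := a) (by omega : i ≤ k) t, ← uIcc_of_le hab]
    refine intervalIntegral.continuousOn_primitive_interval ?_
    rw [uIcc_of_le hab]
    exact ((hw i (by omega)).mul (ih (i + 1) (by omega))).integrableOn_Icc

theorem ContinuousOn.exists_sign_of_ne_zero {a b : ℝ} (hab : a ≤ b) {f : ℝ → ℝ}
    (hf : ContinuousOn f (Icc a b)) (h0 : ∀ t ∈ Icc a b, f t ≠ 0) :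
    ∃ σ : ℝ, σ * σ = 1 ∧ ∀ t ∈ Icc a b, 0 < σ * f t := by
  have ha : a ∈ Icc a b := left_mem_Icc.2 hab
  rcases (h0 a ha).lt_or_gt with hlt | hgt
  · refine ⟨-1, by norm_num, fun t ht ↦ by_contra fun hn ↦ ?_⟩
    obtain ⟨s, hs, hs0⟩ := isPreconnected_Icc.intermediate_value ha ht hf
      (show (0 : ℝ) ∈ Icc (f a) (f t) from ⟨hlt.le, by linarith⟩)
    exact h0 s hs hs0
  · refine ⟨1, by norm_num, fun t ht ↦ by_contra fun hn ↦ ?_⟩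
    obtain ⟨s, hs, hs0⟩ := isPreconnected_Icc.intermediate_value ht ha hf
      (show (0 : ℝ) ∈ Icc (f t) (f a) from ⟨by linarith, hgt.le⟩)
    exact h0 s hs hs0

theorem iteratedDerivWithin_mul_eq_zero {s : Set ℝ} (hs : UniqueDiffOn ℝ s) {t : ℝ} (ht : t ∈ s)
    {n : ℕ} {f g : ℝ → ℝ} (hf : ContDiffOn ℝ n f s) (hg : ContDiffOn ℝ n g s)
    (h : ∀ j ≤ n, iteratedDerivWithin j g s t = 0) : iteratedDerivWithin n (f * g) s t = 0 := by
  rw [iteratedDerivWithin_mul ht hs (hf t ht) (hg t ht)]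
  exact Finset.sum_eq_zero fun i _ ↦ by simp [h (n - i) (by omega)]

/-- If `e 0, …, e N` is an extended complete Chebyshev system (for all `k ≤ N`, a nontrivial
combination of `e 0, …, e k` has no zero of order `k + 1`), then its members are combinations of
the nested integrals of suitable positive weights. -/
theorem exists_weights_of_extended_complete {a b : ℝ} (hab : a < b) (N : ℕ) (e : ℕ → ℝ → ℝ)
    (he : ∀ k ≤ N, ContDiffOn ℝ N (e k) (Icc a b))
    (hW : ∀ k ≤ N, ∀ t ∈ Icc a b, ∀ μ : ℕ → ℝ,
      (∀ j ≤ k, iteratedDerivWithin j (fun x ↦ ∑ i ∈ Finset.range (k + 1), μ i * e i x)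
        (Icc a b) t = 0) → ∀ i ≤ k, μ i = 0) :
    ∃ w : ℕ → ℝ → ℝ, (∀ i ≤ N, ContDiffOn ℝ (N - i : ℕ) (w i) (Icc a b)) ∧
      (∀ i ≤ N, ∀ t ∈ Icc a b, 0 < w i t) ∧
      ∀ k ≤ N, ∃ ν : ℕ → ℝ, ∀ t ∈ Icc a b,
        e k t = ∑ i ∈ Finset.range (N + 1), ν i * (w 0 t * nestInt w a 1 i t) := by
  have hu := uniqueDiffOn_Icc hab
  have hne : ∀ t ∈ Icc a b, e 0 t ≠ 0 := fun t ht h0 ↦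
    one_ne_zero (hW 0 (Nat.zero_le N) t ht (fun _ ↦ 1) (by simp [h0]) 0 le_rfl)
  obtain ⟨σ, hσ, hpos⟩ :=
    (he 0 (Nat.zero_le N)).continuousOn.exists_sign_of_ne_zero hab.le hne
  induction N generalizing e σ with
  | zero =>
    refine ⟨fun _ t ↦ σ * e 0 t, fun i _ ↦ ?_, fun i _ ↦ hpos, fun k hk ↦ ⟨fun _ ↦ σ, ?_⟩⟩
    · simpa using contDiffOn_const.mul (he 0 le_rfl)
    · obtain rfl : k = 0 := by omega
      intro t _
      simp [nestInt_of_lt, ← mul_assoc, hσ]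
  | succ N ih =>
    set w₀ : ℝ → ℝ := fun t ↦ σ * e 0 t with hw₀_def
    have hw₀ : ContDiffOn ℝ (N + 1 : ℕ) w₀ (Icc a b) := contDiffOn_const.mul (he 0 (by omega))
    have hw₀_ne : ∀ t ∈ Icc a b, w₀ t ≠ 0 := fun t ht ↦ (hpos t ht).ne'
    let q (j : ℕ) (t : ℝ) : ℝ := e (j + 1) t / w₀ t
    have hq (j : ℕ) (hj : j ≤ N) : ContDiffOn ℝ (N + 1 : ℕ) (q j) (Icc a b) :=
      (he (j + 1) (by omega)).div hw₀ hw₀_ne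
    let e' (j : ℕ) : ℝ → ℝ := derivWithin (q j) (Icc a b)
    have he' : ∀ k ≤ N, ContDiffOn ℝ N (e' k) (Icc a b) := fun k hk ↦
      (hq k hk).derivWithin hu (by simp)
    have hW' : ∀ k ≤ N, ∀ t ∈ Icc a b, ∀ μ : ℕ → ℝ,
        (∀ j ≤ k, iteratedDerivWithin j (fun x ↦ ∑ i ∈ Finset.range (k + 1), μ i * e' i x)
          (Icc a b) t = 0) → ∀ i ≤ k, μ i = 0 := by
      intro k hk t ht μ hμ
      have hqk : ∀ i ∈ Finset.range (k + 1), ContDiffOn ℝ (N + 1 : ℕ) (q i) (Icc a b) :=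
        fun i hi ↦ hq i (by have := Finset.mem_range.1 hi; omega)
      let g (x : ℝ) : ℝ := ∑ i ∈ Finset.range (k + 1), μ i * q i x
      let h (x : ℝ) : ℝ := g x - g t
      have hg : ContDiffOn ℝ (N + 1 : ℕ) g (Icc a b) :=
        .sum fun i hi ↦ contDiffOn_const.mul (hqk i hi)
      have hh : ContDiffOn ℝ (N + 1 : ℕ) h (Icc a b) := hg.sub contDiffOn_const
      have hderiv : EqOn (derivWithin h (Icc a b))
          (fun x ↦ ∑ i ∈ Finset.range (k + 1), μ i * e' i x) (Icc a b) := by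
        intro x hx
        have hqd : ∀ i ∈ Finset.range (k + 1), DifferentiableWithinAt ℝ (q i) (Icc a b) x :=
          fun i hi ↦ (hqk i hi).differentiableOn (by simp) x hx
        simp only [h, g]
        rw [derivWithin_sub_const, derivWithin_fun_sum fun i hi ↦ (hqd i hi).const_mul _]
        exact Finset.sum_congr rfl fun i hi ↦ derivWithin_const_mul _ (hqd i hi)
      have hhz : ∀ j ≤ k + 1, iteratedDerivWithin j h (Icc a b) t = 0 := by
        rintro (_ | j) hj
        · simp [h]
        · rw [iteratedDerivWithin_succ', iteratedDerivWithin_congr hderiv ht]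
          exact hμ j (by omega)
      let μ' : ℕ → ℝ := fun i ↦ i.casesOn (-(g t * σ)) μ
      have hcomb : EqOn (fun x ↦ ∑ i ∈ Finset.range (k + 1 + 1), μ' i * e i x) (w₀ * h)
          (Icc a b) := by
        intro x hx
        have : ∑ i ∈ Finset.range (k + 1), μ i * e (i + 1) x = w₀ x * g x := by
          rw [Finset.mul_sum]
          refine Finset.sum_congr rfl fun i _ ↦ ?_
          simp only [q]
          field_simp [hw₀_ne x hx]
        have hsum : ∑ i ∈ Finset.range (k + 1 + 1), μ' i * e i x =
            w₀ x * g x + -(g t * σ) * e 0 x := by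
          rw [Finset.sum_range_succ', ← this]
          rfl
        simp only [hsum, Pi.mul_apply, h, hw₀_def]
        ring
      intro i hi
      refine hW (k + 1) (by omega) t ht μ' (fun j hj ↦ ?_) (i + 1) (by omega)
      have hjN : (j : WithTop ℕ∞) ≤ (N + 1 : ℕ) := by exact_mod_cast (by omega : j ≤ N + 1)
      rw [iteratedDerivWithin_congr hcomb ht]
      exact iteratedDerivWithin_mul_eq_zero hu ht (hw₀.of_le hjN) (hh.of_le hjN)
        fun l hl ↦ hhz l (hl.trans hj)
    have hne' : ∀ t ∈ Icc a b, e' 0 t ≠ 0 := fun t ht h0 ↦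
      one_ne_zero (hW' 0 (Nat.zero_le N) t ht (fun _ ↦ 1) (by simp [h0]) 0 le_rfl)
    obtain ⟨σ', hσ', hpos'⟩ :=
      (he' 0 (Nat.zero_le N)).continuousOn.exists_sign_of_ne_zero hab.le hne'
    obtain ⟨w', hw'c, hw'pos, hw'⟩ := ih e' he' hW' hne' σ' hσ' hpos'
    let w : ℕ → ℝ → ℝ := fun n ↦ n.casesOn w₀ w'
    refine ⟨w, ?_, ?_, ?_⟩
    · rintro (_ | i) hi
      · exact hw₀
      · rw [Nat.add_sub_add_right]
        exact hw'c i (by omega)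
    · rintro (_ | i) hi
      · exact hpos
      · exact hw'pos i (by omega)
    have hnest (i : ℕ) (t : ℝ) :
        nestInt w a 1 (i + 1) t = ∫ s in a..t, w' 0 s * nestInt w' a 1 i s := by
      rw [nestInt_succ_succ, nestInt_of_le (Nat.zero_le i)]
    rintro (_ | k) hk
    · refine ⟨fun i ↦ i.casesOn σ fun _ ↦ 0, fun t ht ↦ ?_⟩
      simp [Finset.sum_range_succ' _ (N + 1), nestInt_of_lt, w, hw₀_def, ← mul_assoc, hσ]
    · obtain ⟨ν, hν⟩ := hw' k (by omega)
      refine ⟨fun i ↦ i.casesOn (q k a) ν, fun t ht ↦ ?_⟩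
      have hsub : uIcc a t ⊆ Icc a b := uIcc_of_le ht.1 ▸ Icc_subset_Icc_right ht.2
      have hint : ∀ i ∈ Finset.range (N + 1), IntervalIntegrable
          (fun s ↦ ν i * (w' 0 s * nestInt w' a 1 i s)) MeasureTheory.volume a t := by
        intro i hi
        have hi := Finset.mem_range.1 hi
        have hc : ∀ n ≤ i, ContinuousOn (w' n) (Icc a b) := fun n hn ↦
          (hw'c n (by omega)).continuousOn
        exact ((continuousOn_const.mul ((hc 0 (Nat.zero_le i)).mul
          (continuousOn_nestInt hab.le hc 1))).mono hsub).intervalIntegrable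
      have hftc := integral_derivWithin_Icc_eq_sub hab
        ((hq k (by omega)).of_le (by exact_mod_cast (by omega : 1 ≤ N + 1))) ht
      rw [intervalIntegral.integral_congr fun s hs ↦ hν s (hsub hs),
        intervalIntegral.integral_finsetSum hint] at hftc
      simp only [intervalIntegral.integral_const_mul, ← hnest] at hftc
      have hqk : e (k + 1) t = w₀ t * q k t := by
        simp only [q]
        field_simp [hw₀_ne t ht]
      rw [Finset.sum_range_succ', nestInt_of_lt Nat.zero_lt_one, hqk,
        eq_add_of_sub_eq hftc.symm, mul_add, Finset.mul_sum]
      rw [mul_one]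
      exact congrArg₂ _ (Finset.sum_congr rfl fun i _ ↦ mul_left_comm _ _ _) (mul_comm _ _)

/-- **Representation of Extended Chebyshev systems.** If `u₀, …, u_N` are linearly
independent `C^N` functions on `[a,b]` whose span `U` has the ET-property (an element
of `U` with at least `N+1` zeros in `[a,b]` counted with multiplicities vanishes
identically on `[a,b]`), then there are positive weights `w i` of class `C^{N-i}` on
`[a,b]` such that the functions `v_k t = w₀ t * ∫_a^t w₁ ⋯ ∫_a^{t_{k-1}} w_k` form a
basis of `U`. -/
theorem extended_chebyshev_representation (a b : ℝ) (hab : a < b) (N : ℕ)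
    (u : Fin (N + 1) → ℝ → ℝ)
    (hreg : ∀ j, ContDiffOn ℝ N (u j) (Set.Icc a b))
    (hind : LinearIndependent ℝ fun j => (Set.Icc a b).restrict (u j))
    (hET : ∀ (lam : Fin (N + 1) → ℝ) (m : ℕ) (t : Fin m → ℝ),
      (∀ j, t j ∈ Set.Icc a b) → Function.Injective t →
      ∀ d : Fin m → ℕ, N + 1 ≤ ∑ j, (d j + 1) →
      (∀ (j : Fin m) (k : ℕ), k ≤ d j →
        iteratedDerivWithin k (fun x => ∑ i : Fin (N + 1), lam i * u i x)
          (Set.Icc a b) (t j) = 0) →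
      ∀ x ∈ Set.Icc a b, ∑ i : Fin (N + 1), lam i * u i x = 0) :
    ∃ w : ℕ → ℝ → ℝ,
      (∀ i : ℕ, i ≤ N → ContDiffOn ℝ (N - i : ℕ) (w i) (Set.Icc a b)) ∧
      (∀ i : ℕ, i ≤ N → ∀ t ∈ Set.Icc a b, 0 < w i t) ∧
      LinearIndependent ℝ
        (fun k : Fin (N + 1) =>
          (Set.Icc a b).restrict fun t => w 0 t * nestInt w a 1 k t) ∧
      Submodule.span ℝ
          (Set.range fun k : Fin (N + 1) =>
            (Set.Icc a b).restrict fun t => w 0 t * nestInt w a 1 k t) =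
        Submodule.span ℝ (Set.range fun j => (Set.Icc a b).restrict (u j)) := by
  have hu := uniqueDiffOn_Icc hab
  choose g hg hgu using fun j ↦ (hreg j).exists_contDiff_eqOn_Icc hab N
  have hiter (lam : Fin (N + 1) → ℝ) (j : ℕ) (hj : j ≤ N) (x : ℝ) (hx : x ∈ Icc a b) :
      iteratedDerivWithin j (fun y ↦ ∑ i, lam i * g i y) (Icc a b) x =
        ∑ i, lam i * iteratedDeriv j (g i) x := by
    rw [iteratedDerivWithin_eq_iteratedDeriv hu _ hx, iteratedDeriv_linear_combination hj hg]
    exact ((ContDiff.sum fun i _ ↦ contDiff_const.mul (hg i)).of_le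
      (by exact_mod_cast hj)).contDiffAt
  have hiter_u (lam : Fin (N + 1) → ℝ) (j : ℕ) (hj : j ≤ N) (x : ℝ) (hx : x ∈ Icc a b) :
      iteratedDerivWithin j (fun y ↦ ∑ i, lam i * u i y) (Icc a b) x =
        ∑ i, lam i * iteratedDeriv j (g i) x := by
    rw [← hiter lam j hj x hx]
    exact iteratedDerivWithin_congr (fun y hy ↦ by simp only [hgu _ hy]) hx
  have hzero (lam : Fin (N + 1) → ℝ) (h : ∀ x ∈ Icc a b, ∑ i, lam i * u i x = 0) : lam = 0 :=
    funext (Fintype.linearIndependent_iff.1 hind lam (by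
      ext x
      simp only [Finset.sum_apply, Pi.smul_apply, smul_eq_mul]
      exact h x x.2))
  have hb : b ∈ Icc a b := right_mem_Icc.2 hab.le
  have hET_one (t : ℝ) (ht : t ∈ Icc a b) (lam : Fin (N + 1) → ℝ)
      (h : ∀ j < N + 1, ∑ i, lam i * iteratedDeriv j (g i) t = 0) : lam = 0 := by
    refine hzero lam (hET lam 1 (fun _ ↦ t) (fun _ ↦ ht) (Function.injective_of_subsingleton _)
      (fun _ ↦ N) (by simp) fun _ k hk ↦ ?_)
    rw [hiter_u lam k hk t ht]
    exact h k (by omega)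
  obtain ⟨c, hbc, hc⟩ := exists_gt_hermite_unique (a := a) (b := b) hg (by
    intro p q hpq t ht htb lam hp hq
    by_cases hp0 : p = 0
    · exact hET_one b hb lam fun j hj ↦ hq j (by omega)
    by_cases hq0 : q = 0
    · exact hET_one t ht lam fun j hj ↦ hp j (by omega)
    have htb : t ≠ b := (htb.resolve_right hp0).ne
    refine hzero lam (hET lam 2 ![t, b] ?_ ?_ ![p - 1, q - 1] ?_ ?_)
    · simpa [Fin.forall_fin_two] using ⟨ht, hab.le⟩
    · intro i j
      fin_cases i <;> fin_cases j <;> simp [htb, htb.symm]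
    · simp only [Fin.sum_univ_two, Matrix.cons_val_zero, Matrix.cons_val_one]
      omega
    · simp only [Fin.forall_fin_two, Matrix.cons_val_zero, Matrix.cons_val_one]
      refine ⟨fun k hk ↦ ?_, fun k hk ↦ ?_⟩
      · rw [hiter_u lam k (by omega) t ht]
        exact hp k (by omega)
      · rw [hiter_u lam k (by omega) b hb]
        exact hq k (by omega))
  let A : (Fin (N + 1) → ℝ) →ₗ[ℝ] (Fin (N + 1) → ℝ) :=
    (Matrix.of fun i j : Fin (N + 1) ↦ iteratedDeriv j (g i) c).vecMulLinear
  have hA (lam : Fin (N + 1) → ℝ) (j : Fin (N + 1)) :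
      A lam j = ∑ i, lam i * iteratedDeriv j (g i) c := rfl
  have hAinj : Function.Injective A := (injective_iff_map_eq_zero A).2 fun lam h ↦
    hc 0 (N + 1) (by omega) a (left_mem_Icc.2 hab.le) lam (by simp)
      fun j hj ↦ (hA lam ⟨j, hj⟩).symm.trans (congrFun h _)
  let L := LinearEquiv.ofInjectiveEndo A hAinj
  let l (k : ℕ) : Fin (N + 1) → ℝ := L.symm fun j ↦ if (j : ℕ) + k = N then 1 else 0
  have hl (k : ℕ) (j : Fin (N + 1)) : A (l k) j = if (j : ℕ) + k = N then 1 else 0 :=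
    congrFun (L.apply_symm_apply _) j
  have hl_sum (μ : ℕ → ℝ) (n : ℕ) (j : Fin (N + 1)) :
      A (∑ k ∈ Finset.range n, μ k • l k) j = if N - j < n then μ (N - j) else 0 := by
    simp only [map_sum, map_smul, Finset.sum_apply, Pi.smul_apply, hl, smul_eq_mul, mul_ite,
      mul_one, mul_zero]
    rw [Finset.sum_congr rfl fun k _ ↦ if_congr
      (show (j : ℕ) + k = N ↔ N - j = k by omega) rfl rfl]
    simp
  let e (k : ℕ) (x : ℝ) : ℝ := ∑ i, l k i * g i x
  have he_sum (μ : ℕ → ℝ) (n : ℕ) (x : ℝ) : ∑ k ∈ Finset.range n, μ k * e k x =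
      ∑ i, (∑ k ∈ Finset.range n, μ k • l k) i * g i x := by
    simp only [e, Finset.sum_apply, Pi.smul_apply, smul_eq_mul, Finset.sum_mul, Finset.mul_sum]
    rw [Finset.sum_comm]
    simp only [mul_assoc]
  obtain ⟨w, hwc, hwpos, hw⟩ := exists_weights_of_extended_complete hab N e
    (fun k _ ↦ (ContDiff.sum fun i _ ↦ contDiff_const.mul (hg i)).contDiffOn) (by
      intro k hk t ht μ hμ i hi
      have hlam : ∑ k ∈ Finset.range (k + 1), μ k • l k = 0 := by
        refine hc (k + 1) (N - k) (by omega) t ht _ (fun j hj ↦ ?_) fun j hj ↦ ?_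
        · rw [← hiter _ j (by omega) t ht]
          simpa only [he_sum] using hμ j (by omega)
        · refine (hA _ ⟨j, by omega⟩).symm.trans ?_
          rw [hl_sum, if_neg (by simp only; omega)]
      have := hl_sum μ (k + 1) ⟨N - i, by omega⟩
      rw [hlam, map_zero] at this
      simpa [show N - (N - i) = i by omega, show i < k + 1 by omega] using this.symm)
  refine ⟨w, hwc, hwpos, ?_⟩
  set v : Fin (N + 1) → Icc a b → ℝ :=
    fun k ↦ (Icc a b).restrict fun t ↦ w 0 t * nestInt w a 1 k t
  have he_mem (k : ℕ) (hk : k ≤ N) :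
      (Icc a b).domRestrict (e k) ∈ Submodule.span ℝ (range v) := by
    obtain ⟨ν, hν⟩ := hw k hk
    have : (Icc a b).domRestrict (e k) = ∑ i : Fin (N + 1), ν i • v i := by
      ext t
      simp only [domRestrict_apply, hν t t.2, Finset.sum_range, Finset.sum_apply, Pi.smul_apply,
        smul_eq_mul]
      rfl
    rw [this]
    exact Submodule.sum_mem _ fun i _ ↦ Submodule.smul_mem _ _ (Submodule.subset_span ⟨i, rfl⟩)
  have hle : Submodule.span ℝ (range fun j ↦ (Icc a b).restrict (u j)) ≤
      Submodule.span ℝ (range v) := by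
    rw [Submodule.span_le]
    rintro _ ⟨j, rfl⟩
    let μ (k : ℕ) : ℝ := A (Pi.single j 1) (Fin.ofNat (N + 1) (N - k))
    have hμ : ∑ k ∈ Finset.range (N + 1), μ k • l k = Pi.single j 1 := by
      refine hAinj (funext fun i ↦ ?_)
      rw [hl_sum, if_pos (by omega)]
      refine congrArg (A (Pi.single j 1)) (Fin.ext ?_)
      simp [show N - (N - (i : ℕ)) = i by omega]
    have : (Icc a b).restrict (u j) =
        ∑ k ∈ Finset.range (N + 1), μ k • (Icc a b).domRestrict (e k) := by
      ext t
      have := he_sum μ (N + 1) t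
      rw [hμ] at this
      simp only [Finset.sum_apply, Pi.smul_apply, smul_eq_mul, domRestrict_apply, this]
      simp only [Pi.single_apply, ite_mul, one_mul, zero_mul, Finset.sum_ite_eq', Finset.mem_univ,
        if_true, hgu j t.2]
      rfl
    simp only [SetLike.mem_coe, this]
    exact Submodule.sum_mem _ fun k hk ↦ Submodule.smul_mem _ _
      (he_mem k (by have := Finset.mem_range.1 hk; omega))
  have : FiniteDimensional ℝ (Submodule.span ℝ (range v)) := .span_of_finite ℝ (finite_range v)
  have hcard : Module.finrank ℝ (Submodule.span ℝ (range v)) ≤ Fintype.card (Fin (N + 1)) :=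
    finrank_range_le_card v
  have hfr := linearIndependent_iff_card_eq_finrank_span.1 hind
  have heq := Submodule.eq_of_le_of_finrank_le hle (hcard.trans hfr.le)
  refine ⟨linearIndependent_iff_card_eq_finrank_span.2 ?_, heq.symm⟩
  rw [hfr, Set.finrank, Set.finrank, heq]
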